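/- Let γ be a translation-invariant monotonicity-preserving specification, let γ^(±)_Λ(·|ω) = lim_{S↑𝕃} γ_Λ(·|ω_S ±_{Sᶜ}) be the right- and left-continuous specifications obtained as monotone limits, and let μ± = lim_{Λ↑𝕃} γ_Λ(·|±) be the extremal '+' and '−' measures. If h(μ⁻|μ⁺) = 0, then μ⁻ ∈ 𝒢(γ^(+)) and μ⁻(Ω_{γ^(+)}) = μ⁻(Ω_{γ^(−)}) = 1, where Ω_π denotes the set of configurations at which π_Λ f is continuous for all Λ ∈ 𝒮 and all local f; hence μ⁻ is almost quasilocal. The analogous statement holds with '+' and '−' interchanged. -/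

import Mathlib

open MeasureTheory Filter Topology
open scoped ENNReal MeasureTheory Classical

noncomputable section

/-- The σ-algebra on configuration space generated by the coordinates in `Δ`. -/
def cylinderSigma (Ω₀ : Type*) [MeasurableSpace Ω₀] {ι : Type*} (Δ : Set ι) :
    MeasurableSpace (ι → Ω₀) :=
  MeasurableSpace.comap (fun ω (x : Δ) => ω (x : ι)) MeasurableSpace.pi

/-- The configuration agreeing with `ω` on `S` and with `θ` off `S`. -/
def splice {ι Ω₀ : Type*} (S : Set ι) (ω θ : ι → Ω₀) : ι → Ω₀ :=
  fun x => if x ∈ S then ω x else θ x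

/-- A function is local if it is measurable with respect to a finite cylinder σ-algebra. -/
def IsLocal {ι Ω₀ : Type*} [MeasurableSpace Ω₀] (f : (ι → Ω₀) → ℝ) : Prop :=
  ∃ Δ : Finset ι, Measurable[cylinderSigma Ω₀ (Δ : Set ι)] f

/-- Quasilocality of `f` in the direction `θ`. -/
def QuasilocalInDir {ι Ω₀ : Type*} (θ : ι → Ω₀) (f : (ι → Ω₀) → ℝ) : Prop :=
  ∀ ω, Tendsto (fun S : Finset ι => f (splice (S : Set ι) ω θ)) atTop (𝓝 (f ω))

/-- `f` is quasilocal: a uniform limit of local functions. -/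
def IsQuasilocal {ι Ω₀ : Type*} [MeasurableSpace Ω₀] (f : (ι → Ω₀) → ℝ) : Prop :=
  ∀ ε : ℝ, 0 < ε → ∃ g, IsLocal g ∧ ∀ ω, |f ω - g ω| ≤ ε

/-- A specification: a proper consistent family of probability kernels indexed by
finite subsets of the site space. -/
structure Specification (ι Ω₀ : Type*) [MeasurableSpace Ω₀] where
  k : Finset ι → (ι → Ω₀) → Measure (ι → Ω₀)
  isProb : ∀ Λ ω, IsProbabilityMeasure (k Λ ω)
  meas : ∀ (Λ : Finset ι) (A : Set (ι → Ω₀)), MeasurableSet A →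
    Measurable[cylinderSigma Ω₀ ((Λ : Set ι))ᶜ] (fun ω => k Λ ω A)
  proper : ∀ (Λ : Finset ι) (B : Set (ι → Ω₀)),
    MeasurableSet[cylinderSigma Ω₀ ((Λ : Set ι))ᶜ] B → ∀ ω, k Λ ω B = B.indicator 1 ω
  consistent : ∀ ⦃Λ Λ' : Finset ι⦄, Λ ⊆ Λ' → ∀ ω, (k Λ' ω).bind (k Λ) = k Λ' ω

/-- `γ_Λ f`, the expectation of `f` under the kernel of the specification. -/
def specInt {ι Ω₀ : Type*} [MeasurableSpace Ω₀] (γ : Specification ι Ω₀)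
    (Λ : Finset ι) (f : (ι → Ω₀) → ℝ) (ω : ι → Ω₀) : ℝ :=
  ∫ x, f x ∂(γ.k Λ ω)

/-- DLR consistency of a measure with a specification. -/
def IsGibbs {ι Ω₀ : Type*} [MeasurableSpace Ω₀] (γ : Specification ι Ω₀)
    (μ : Measure (ι → Ω₀)) : Prop :=
  ∀ Λ, μ.bind (γ.k Λ) = μ

/-- A specification is quasilocal in the direction `θ`. -/
def SpecQuasilocalInDir {ι Ω₀ : Type*} [MeasurableSpace Ω₀] (γ : Specification ι Ω₀)
    (θ : ι → Ω₀) : Prop :=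
  ∀ Λ f, IsLocal f → QuasilocalInDir θ (specInt γ Λ f)

/-- A quasilocal specification. -/
def IsSpecQuasilocal {ι Ω₀ : Type*} [MeasurableSpace Ω₀] (γ : Specification ι Ω₀) : Prop :=
  ∀ Λ f, IsLocal f → IsQuasilocal (specInt γ Λ f)

/-- A monotonicity-preserving specification. -/
def MonoPreserving {ι Ω₀ : Type*} [MeasurableSpace Ω₀] [Preorder Ω₀]
    (γ : Specification ι Ω₀) : Prop :=
  ∀ Λ (f : (ι → Ω₀) → ℝ), Measurable f → Monotone f → Monotone (specInt γ Λ f)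

/-- `γ'` is the limit of `γ` with boundary condition forced to `θ` outside larger
and larger volumes. -/
def IsDirLimitSpec {ι Ω₀ : Type*} [MeasurableSpace Ω₀] (γ γ' : Specification ι Ω₀)
    (θ : ι → Ω₀) : Prop :=
  ∀ Λ f, IsLocal f → ∀ ω,
    Tendsto (fun S : Finset ι => specInt γ Λ f (splice (S : Set ι) ω θ)) atTop
      (𝓝 (specInt γ' Λ f ω))

/-- `μ` is the weak limit `lim_{Λ↑𝕃} γ_Λ(⬝|θ)`. -/
def IsLimitWithBoundary {ι Ω₀ : Type*} [MeasurableSpace Ω₀] (γ : Specification ι Ω₀)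
    (θ : ι → Ω₀) (μ : Measure (ι → Ω₀)) : Prop :=
  IsProbabilityMeasure μ ∧
    ∀ f, IsLocal f → Tendsto (fun Λ : Finset ι => specInt γ Λ f θ) atTop (𝓝 (∫ ω, f ω ∂μ))

/-- The set of configurations at which all the `γ_Λ f` (`f` local) are continuous. -/
def contSet {ι Ω₀ : Type*} [MeasurableSpace Ω₀] [TopologicalSpace Ω₀]
    (γ : Specification ι Ω₀) : Set (ι → Ω₀) :=
  {ω | ∀ Λ f, IsLocal f → ContinuousAt (specInt γ Λ f) ω}

/-- An almost quasilocal probability measure. -/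
def AlmostQuasilocal {ι Ω₀ : Type*} [MeasurableSpace Ω₀] [TopologicalSpace Ω₀]
    (μ : Measure (ι → Ω₀)) : Prop :=
  ∃ γ : Specification ι Ω₀, IsGibbs γ μ ∧ μ (contSet γ) = 1

/-- Sites of the lattice `ℤ^d`. -/
abbrev Site (d : ℕ) := Fin d → ℤ

/-- The cube `Λ_n = ([-n,n] ∩ ℤ)^d`. -/
def cube (d : ℕ) (n : ℕ) : Finset (Site d) :=
  Fintype.piFinset fun _ => Finset.Icc (-(n : ℤ)) (n : ℤ)

/-- Translation of a configuration by `i`. -/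
def shift {Ω₀ : Type*} {d : ℕ} (i : Site d) (ω : Site d → Ω₀) : Site d → Ω₀ :=
  fun x => ω (x - i)

/-- Translation invariance of a measure. -/
def TransInv {Ω₀ : Type*} [MeasurableSpace Ω₀] {d : ℕ} (μ : Measure (Site d → Ω₀)) : Prop :=
  ∀ i : Site d, μ.map (shift i) = μ

/-- Translation invariance of a specification. -/
def TransInvSpec {Ω₀ : Type*} [MeasurableSpace Ω₀] {d : ℕ}
    (γ : Specification (Site d) Ω₀) : Prop :=
  ∀ (i : Site d) (Λ : Finset (Site d)) (ω),
    γ.k (Λ.image (· + i)) (shift i ω) = (γ.k Λ ω).map (shift i)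

/-- Restriction (projection) of a measure to the coordinates in `Δ`. -/
def restrictTo {ι Ω₀ : Type*} [MeasurableSpace Ω₀] (Δ : Finset ι)
    (μ : Measure (ι → Ω₀)) : Measure ({x // x ∈ Δ} → Ω₀) :=
  μ.map (fun ω (x : {x // x ∈ Δ}) => ω (x : ι))

/-- The Radon–Nikodym density `dμ_Δ/dν_Δ`, viewed as a function on configuration space. -/
def density {ι Ω₀ : Type*} [MeasurableSpace Ω₀] (Δ : Finset ι)
    (μ ν : Measure (ι → Ω₀)) : (ι → Ω₀) → ℝ :=
  fun ω => ((restrictTo Δ μ).rnDeriv (restrictTo Δ ν) (fun x : {x // x ∈ Δ} => ω (x : ι))).toReal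

/-- Relative entropy `H_Δ(μ|ν)` at the finite volume `Δ` (`+∞` if `μ_Δ` is not
absolutely continuous with respect to `ν_Δ`). -/
def relEnt {ι Ω₀ : Type*} [MeasurableSpace Ω₀] (Δ : Finset ι)
    (μ ν : Measure (ι → Ω₀)) : ℝ≥0∞ :=
  if restrictTo Δ μ ≪ restrictTo Δ ν then
    ENNReal.ofReal (∫ ω, density Δ μ ν ω * Real.log (density Δ μ ν ω) ∂ν)
  else ⊤

/-- Vanishing relative entropy density: `h(μ|ν) = 0`. -/
def EntDensityZero {Ω₀ : Type*} [MeasurableSpace Ω₀] {d : ℕ}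
    (μ ν : Measure (Site d → Ω₀)) : Prop :=
  Tendsto (fun n => relEnt (cube d n) μ ν / ((cube d n).card : ℝ≥0∞)) atTop (𝓝 0)


section Helpers

set_option linter.unusedSectionVars false
set_option linter.style.haveILetI false
set_option linter.unusedVariables false

variable {ι Ω₀ : Type*} [MeasurableSpace Ω₀]

/-- bounded measurable functions -/
def BM (f : (ι → Ω₀) → ℝ) : Prop := Measurable f ∧ ∃ C, ∀ ω, |f ω| ≤ C

theorem splice_dep (S : Set ι) (θ : ι → Ω₀) {β : Type*} (f : (ι → Ω₀) → β) :
    DependsOn (fun ω => f (splice S ω θ)) S := by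
  intro x y h
  have : splice S x θ = splice S y θ := by
    funext i
    simp only [splice]
    split_ifs with hi
    · exact h i hi
    · rfl
  simp only [this]

theorem dep_of_meas {β : Type*} [MeasurableSpace β] [MeasurableSingletonClass β]
    {f : (ι → Ω₀) → β} {S : Set ι} (h : Measurable[cylinderSigma Ω₀ S] f) : DependsOn f S := by
  have := Measurable.factorsThrough (h : Measurable[MeasurableSpace.comap _ _] f)
  intro x y hxy
  exact this (by funext i; exact hxy i i.2)

theorem isLocal_dep {f : (ι → Ω₀) → ℝ} (h : IsLocal f) :
    ∃ Δ : Finset ι, DependsOn f (Δ : Set ι) :=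
  let ⟨Δ, hΔ⟩ := h; ⟨Δ, dep_of_meas hΔ⟩

variable [Fintype Ω₀] [DiscreteMeasurableSpace Ω₀]

theorem dep_isLocal {f : (ι → Ω₀) → ℝ} {Δ : Finset ι} (h : DependsOn f (Δ : Set ι)) :
    IsLocal f := by
  obtain ⟨g, hg⟩ := dependsOn_iff_exists_comp.1 h
  refine ⟨Δ, ?_⟩
  rw [hg]
  have hgm : Measurable g := measurable_of_finite g
  exact hgm.comp (comap_measurable _)

theorem cylSigma_le (S : Set ι) : cylinderSigma Ω₀ S ≤ MeasurableSpace.pi := by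
  apply Measurable.comap_le
  exact measurable_pi_lambda _ fun i => measurable_pi_apply _

theorem IsLocal.bm {f : (ι → Ω₀) → ℝ} (h : IsLocal f) : BM f := by
  constructor
  · obtain ⟨Δ, hΔ⟩ := h
    exact hΔ.mono (cylSigma_le _) le_rfl
  · obtain ⟨Δ, hΔ⟩ := isLocal_dep h
    obtain ⟨g, hg⟩ := dependsOn_iff_exists_comp.1 hΔ
    obtain ⟨C, hC⟩ := (Set.finite_range (fun x => |g x|)).bddAbove
    refine ⟨C, fun ω => ?_⟩
    rw [hg]
    exact hC ⟨_, rfl⟩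

theorem IsLocal.op2 {f g : (ι → Ω₀) → ℝ} (hf : IsLocal f) (hg : IsLocal g) (F : ℝ → ℝ → ℝ) :
    IsLocal (fun ω => F (f ω) (g ω)) := by
  obtain ⟨Δ, hΔ⟩ := isLocal_dep hf
  obtain ⟨Δ', hΔ'⟩ := isLocal_dep hg
  apply dep_isLocal (Δ := Δ ∪ Δ')
  intro x y h
  have h1 : f x = f y := hΔ fun i hi => h i (by simp at hi ⊢; exact Or.inl hi)
  have h2 : g x = g y := hΔ' fun i hi => h i (by simp at hi ⊢; exact Or.inr hi)
  simp only [h1, h2]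

theorem isLocal_splice (S : Finset ι) (θ : ι → Ω₀) (f : (ι → Ω₀) → ℝ) :
    IsLocal (fun ω => f (splice (S : Set ι) ω θ)) :=
  dep_isLocal (splice_dep (S : Set ι) θ f)

theorem BM.integrable {f : (ι → Ω₀) → ℝ} (h : BM f) (μ : Measure (ι → Ω₀)) [IsFiniteMeasure μ] :
    Integrable f μ := by
  obtain ⟨hm, C, hC⟩ := h
  exact Integrable.of_bound hm.aestronglyMeasurable C (ae_of_all _ hC)

theorem BM.mul {f g : (ι → Ω₀) → ℝ} (hf : BM f) (hg : BM g) : BM (fun ω => f ω * g ω) := by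
  obtain ⟨hm, C, hC⟩ := hf
  obtain ⟨hm', C', hC'⟩ := hg
  refine ⟨hm.mul hm', C * C', fun ω => ?_⟩
  rw [abs_mul]
  exact mul_le_mul (hC ω) (hC' ω) (abs_nonneg _) ((abs_nonneg _).trans (hC ω))

/-! Measures are determined by local functions. -/
theorem measure_ext_local {μ ν : Measure (ι → Ω₀)} [IsProbabilityMeasure μ]
    [IsProbabilityMeasure ν] (h : ∀ f, IsLocal f → ∫ ω, f ω ∂μ = ∫ ω, f ω ∂ν) : μ = ν := by
  refine ext_of_generate_finite (measurableCylinders fun _ : ι => Ω₀)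
    generateFrom_measurableCylinders.symm isPiSystem_measurableCylinders (fun s hs => ?_) (by simp)
  obtain ⟨Δ, S, hS, rfl⟩ := (mem_measurableCylinders _).1 hs
  have hms : MeasurableSet (cylinder (α := fun _ : ι => Ω₀) Δ S) := hS.cylinder
  have hl : IsLocal ((cylinder (α := fun _ : ι => Ω₀) Δ S).indicator (1 : (ι → Ω₀) → ℝ)) := by
    apply dep_isLocal (Δ := Δ)
    intro x y hxy
    have : Δ.restrict x = Δ.restrict y := by funext i; exact hxy i i.2
    simp only [Set.indicator, mem_cylinder, this, Pi.one_apply]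
  have := h _ hl
  rw [integral_indicator_one hms, integral_indicator_one hms] at this
  exact (measureReal_eq_measureReal_iff).1 this

/-! Kernels -/
section kern
variable [Countable ι] (γ : Specification ι Ω₀)

theorem k_ae (Λ : Finset ι) (ω : ι → Ω₀) : ∀ᵐ ω' ∂(γ.k Λ ω), ∀ x, x ∉ Λ → ω' x = ω x := by
  rw [ae_all_iff]
  intro x
  by_cases hx : x ∈ Λ
  · simp [hx]
  have hB : MeasurableSet[cylinderSigma Ω₀ ((Λ : Set ι))ᶜ] {ω' : ι → Ω₀ | ω' x = ω x} := by
    refine ⟨{g | g ⟨x, by simpa using hx⟩ = ω x}, ?_, rfl⟩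
    exact measurable_pi_apply _ (measurableSet_singleton _)
  have hpr := γ.proper Λ _ hB ω
  have := γ.isProb Λ ω
  have h1 : γ.k Λ ω {ω' : ι → Ω₀ | ω' x = ω x} = 1 := by
    rw [hpr]; simp
  have h2 := (mem_ae_iff_prob_eq_one (cylSigma_le (Ω₀ := Ω₀) _ _ hB)).2 h1
  filter_upwards [h2] with ω' h _ using h

theorem k_congr (Λ : Finset ι) {ω ω' : ι → Ω₀} (h : ∀ x, x ∉ Λ → ω x = ω' x) :
    γ.k Λ ω = γ.k Λ ω' := by
  ext A hA
  exact dep_of_meas (γ.meas Λ A hA) fun i hi => h i (by simpa using hi)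

theorem k_meas (Λ : Finset ι) : Measurable (γ.k Λ) :=
  Measure.measurable_of_measurable_coe _ fun A hA =>
    (γ.meas Λ A hA).mono (cylSigma_le _) le_rfl

/-- kernel -/
def kern (Λ : Finset ι) : ProbabilityTheory.Kernel (ι → Ω₀) (ι → Ω₀) := ⟨γ.k Λ, k_meas γ Λ⟩

instance kern_markov (Λ : Finset ι) : ProbabilityTheory.IsMarkovKernel (kern γ Λ) :=
  ⟨fun ω => γ.isProb Λ ω⟩

theorem specInt_bm {f : (ι → Ω₀) → ℝ} (hf : BM f) (Λ : Finset ι) : BM (specInt γ Λ f) := by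
  obtain ⟨hm, C, hC⟩ := hf
  constructor
  · have : StronglyMeasurable fun ω => ∫ y, f y ∂(kern γ Λ ω) :=
      hm.stronglyMeasurable.integral_kernel
    exact this.measurable
  · refine ⟨C, fun ω => ?_⟩
    have := γ.isProb Λ ω
    have := norm_integral_le_of_norm_le_const (μ := γ.k Λ ω) (f := f) (C := C) (ae_of_all _ hC)
    simpa [specInt] using this

theorem specInt_consist {f : (ι → Ω₀) → ℝ} (hf : BM f) {Λ V : Finset ι} (h : Λ ⊆ V)
    (ω : ι → Ω₀) : specInt γ V (specInt γ Λ f) ω = specInt γ V f ω := by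
  have hc : (ProbabilityTheory.Kernel.comp (kern γ Λ) (kern γ V)) ω = γ.k V ω := by
    rw [ProbabilityTheory.Kernel.comp_apply]
    exact γ.consistent h ω
  have := γ.isProb V ω
  have := ProbabilityTheory.Kernel.integral_comp (κ := kern γ V) (η := kern γ Λ) (a := ω) (f := f)
    (by rw [hc]; exact hf.integrable _)
  rw [hc] at this
  exact this.symm

theorem specInt_mul {f g : (ι → Ω₀) → ℝ} {Λ : Finset ι}
    (hg : DependsOn g ((Λ : Set ι)ᶜ)) (ω : ι → Ω₀) :
    specInt γ Λ (fun x => f x * g x) ω = specInt γ Λ f ω * g ω := by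
  unfold specInt
  rw [← integral_mul_const]
  apply integral_congr_ae
  filter_upwards [k_ae γ Λ ω] with ω' h
  have : g ω' = g ω := hg fun i hi => h i (by simpa using hi)
  simp only [this]

theorem specInt_mono {f g : (ι → Ω₀) → ℝ} (hf : BM f) (hg : BM g) (h : ∀ ω, f ω ≤ g ω)
    (Λ : Finset ι) (ω : ι → Ω₀) : specInt γ Λ f ω ≤ specInt γ Λ g ω := by
  have := γ.isProb Λ ω
  exact integral_mono (hf.integrable _) (hg.integrable _) h

theorem specInt_sub {f g : (ι → Ω₀) → ℝ} (hf : BM f) (hg : BM g) 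
    (Λ : Finset ι) (ω : ι → Ω₀) :
    specInt γ Λ (fun x => f x - g x) ω = specInt γ Λ f ω - specInt γ Λ g ω := by
  have := γ.isProb Λ ω
  exact integral_sub (hf.integrable _) (hg.integrable _)

theorem specInt_congr_out {f : (ι → Ω₀) → ℝ} {g : (ι → Ω₀) → ℝ} 
    (Λ : Finset ι) (ω : ι → Ω₀) (h : ∀ ω', (∀ x, x ∉ Λ → ω' x = ω x) → f ω' = g ω') :
    specInt γ Λ f ω = specInt γ Λ g ω := by
  apply integral_congr_ae
  filter_upwards [k_ae γ Λ ω] with ω' h' using h ω' h'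

end kern
end Helpers

section Order
set_option linter.unusedSectionVars false
set_option linter.style.haveILetI false
set_option linter.unusedVariables false

variable {ι Ω₀ : Type*} [MeasurableSpace Ω₀] [Fintype Ω₀] [DiscreteMeasurableSpace Ω₀]
  [PartialOrder Ω₀] [Countable ι]

/-- rank function -/
def rk (a : Ω₀) : ℝ := ((Finset.univ.filter (· < a)).card : ℝ)

theorem rk_le {a b : Ω₀} (h : a ≤ b) : rk a ≤ rk b := by
  unfold rk
  exact_mod_cast Finset.card_le_card fun x hx => by
    simp at hx ⊢; exact hx.trans_le h

theorem rk_lt {a b : Ω₀} (h : a < b) : rk a + 1 ≤ rk b := by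
  unfold rk
  have : (Finset.univ.filter (· < a)).card < (Finset.univ.filter (· < b)).card := by
    apply Finset.card_lt_card
    rw [Finset.ssubset_iff_of_subset]
    · exact ⟨a, by simpa using h, by simp⟩
    · intro x hx
      simp at hx ⊢; exact hx.trans h
  exact_mod_cast this

theorem local_decomp {h : (ι → Ω₀) → ℝ} (hl : IsLocal h) :
    ∃ h1 h2, IsLocal h1 ∧ IsLocal h2 ∧ Monotone h1 ∧ Monotone h2 ∧ h = fun ω => h1 ω - h2 ω := by
  obtain ⟨Δ, hΔ⟩ := isLocal_dep hl
  obtain ⟨C, hC⟩ := hl.bm.2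
  have hrl : IsLocal (fun ω : ι → Ω₀ => 2 * C * ∑ x ∈ Δ, rk (ω x)) := by
    apply dep_isLocal (Δ := Δ)
    intro x y hxy
    have : ∑ i ∈ Δ, rk (x i) = ∑ i ∈ Δ, rk (y i) :=
      Finset.sum_congr rfl fun i hi => by rw [hxy i hi]
    simp only [this]
  have hmono : Monotone fun ω : ι → Ω₀ => ∑ x ∈ Δ, rk (ω x) := fun ω ω' hw =>
    Finset.sum_le_sum fun i _ => rk_le (hw i)
  refine ⟨fun ω => h ω + 2 * C * ∑ x ∈ Δ, rk (ω x), fun ω => 2 * C * ∑ x ∈ Δ, rk (ω x),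
    hl.op2 hrl (fun a b => a + b), hrl, ?_, ?_, ?_⟩
  · intro ω ω' hw
    have hC0 : 0 ≤ C := (abs_nonneg _).trans (hC ω)
    by_cases he : ∀ x ∈ Δ, ω x = ω' x
    · have h1 : h ω = h ω' := hΔ he
      have := mul_le_mul_of_nonneg_left (hmono hw) (by positivity : 0 ≤ 2 * C)
      simp only at this ⊢
      linarith
    · push Not at he
      obtain ⟨x, hx, hne⟩ := he
      have hlt : ω x < ω' x := lt_of_le_of_ne (hw x) hne
      have : ∑ x ∈ Δ, rk (ω x) + 1 ≤ ∑ x ∈ Δ, rk (ω' x) := by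
        rw [← Finset.add_sum_erase _ _ hx, ← Finset.add_sum_erase _ (fun x => rk (ω' x)) hx]
        have h1 : ∑ x ∈ Δ.erase x, rk (ω x) ≤ ∑ x ∈ Δ.erase x, rk (ω' x) :=
          Finset.sum_le_sum fun i _ => rk_le (hw i)
        have := rk_lt hlt
        linarith
      have h3 := mul_le_mul_of_nonneg_left this (by positivity : 0 ≤ 2 * C)
      have h1 := abs_le.1 (hC ω)
      have h2 := abs_le.1 (hC ω')
      simp only
      linarith
  · intro ω ω' hw
    have hC0 : 0 ≤ C := (abs_nonneg _).trans (hC ω)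
    exact mul_le_mul_of_nonneg_left (hmono hw) (by positivity : 0 ≤ 2 * C)
  · funext ω; ring

variable (γ : Specification ι Ω₀)

theorem bot_vol_mono (hmono : MonoPreserving γ)
    (b : Ω₀) (hb : ∀ x, b ≤ x) {h : (ι → Ω₀) → ℝ} (hl : BM h) (hm : Monotone h)
    {V V' : Finset ι} (hV : V ⊆ V') :
    specInt γ V h (fun _ => b) ≤ specInt γ V' h (fun _ => b) := by
  rw [← specInt_consist γ hl hV]
  have hc : BM (fun _ : ι → Ω₀ => specInt γ V h (fun _ => b)) :=
    ⟨measurable_const, _, fun _ => le_rfl⟩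
  have key := specInt_mono γ hc (specInt_bm γ hl V)
    (fun ω => hmono V h hl.1 hm (fun i => hb (ω i))) V' (fun _ => b)
  have := γ.isProb V' (fun _ => b)
  refine le_trans (le_of_eq ?_) key
  rw [specInt, specInt, integral_const]
  simp

theorem bot_le_lim (hmono : MonoPreserving γ)
    (b : Ω₀) (hb : ∀ x, b ≤ x) {μ : Measure (ι → Ω₀)}
    (hμ : IsLimitWithBoundary γ (fun _ => b) μ) {h : (ι → Ω₀) → ℝ} (hl : IsLocal h)
    (hm : Monotone h) (V : Finset ι) : specInt γ V h (fun _ => b) ≤ ∫ ω, h ω ∂μ := by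
  apply ge_of_tendsto (hμ.2 h hl)
  filter_upwards [eventually_ge_atTop V] with V' hV
  exact bot_vol_mono γ hmono b hb hl.bm hm hV

theorem splice_mono (S : Set ι) (θ : ι → Ω₀) : Monotone (fun ω => splice S ω θ) := by
  intro ω ω' h x
  simp only [splice]
  split_ifs
  · exact h x
  · exact le_rfl

theorem splice_bot_mono (b : Ω₀) (hb : ∀ x, b ≤ x) {S S' : Set ι} (h : S ⊆ S') (ω : ι → Ω₀) :
    splice S ω (fun _ => b) ≤ splice S' ω (fun _ => b) := by
  intro x
  simp only [splice]
  split_ifs with h1 h2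
  · exact le_rfl
  · exact absurd (h h1) h2
  · exact hb _
  · exact le_rfl

theorem splice_bot_le (b : Ω₀) (hb : ∀ x, b ≤ x) (S : Set ι) (ω : ι → Ω₀) :
    splice S ω (fun _ => b) ≤ ω := by
  intro x
  simp only [splice]
  split_ifs with h1
  · exact le_rfl
  · exact hb _

theorem dir_le (hmono : MonoPreserving γ)
    (b : Ω₀) (hb : ∀ x, b ≤ x) {γm : Specification ι Ω₀}
    (hγm : IsDirLimitSpec γ γm (fun _ => b)) {f : (ι → Ω₀) → ℝ} (hl : IsLocal f)
    (hm : Monotone f) (Λ S : Finset ι) (ω : ι → Ω₀) :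
    specInt γ Λ f (splice (S : Set ι) ω (fun _ => b)) ≤ specInt γm Λ f ω := by
  apply ge_of_tendsto (hγm Λ f hl ω)
  filter_upwards [eventually_ge_atTop S] with V' hV
  exact hmono Λ f hl.bm.1 hm (splice_bot_mono b hb (by exact_mod_cast hV) ω)

theorem dir_monotone (hmono : MonoPreserving γ)
    {θ : ι → Ω₀} {γm : Specification ι Ω₀}
    (hγm : IsDirLimitSpec γ γm θ) {f : (ι → Ω₀) → ℝ} (hl : IsLocal f)
    (hm : Monotone f) (Λ : Finset ι) : Monotone (specInt γm Λ f) := by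
  intro ω ω' h
  exact le_of_tendsto_of_tendsto' (hγm Λ f hl ω) (hγm Λ f hl ω')
    fun S => hmono Λ f hl.bm.1 hm (splice_mono _ _ h)

theorem dir_bot_le_top (hmono : MonoPreserving γ)
    (b t : Ω₀) (hb : ∀ x, b ≤ x) {γm γp : Specification ι Ω₀}
    (hγm : IsDirLimitSpec γ γm (fun _ => b)) (hγp : IsDirLimitSpec γ γp (fun _ => t))
    {f : (ι → Ω₀) → ℝ} (hl : IsLocal f)
    (hm : Monotone f) (Λ : Finset ι) (ω : ι → Ω₀) : specInt γm Λ f ω ≤ specInt γp Λ f ω := by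
  refine le_of_tendsto_of_tendsto' (hγm Λ f hl ω) (hγp Λ f hl ω)
    fun S => hmono Λ f hl.bm.1 hm ?_
  intro x
  simp only [splice]
  split_ifs
  · exact le_rfl
  · exact hb _

/-- convergence of integrals along the directed limit, with a bounded weight -/
theorem dir_integral {θ : ι → Ω₀} {γm : Specification ι Ω₀}
    (hγm : IsDirLimitSpec γ γm θ) {f : (ι → Ω₀) → ℝ} (hl : IsLocal f) (Λ : Finset ι)
    {e : (ι → Ω₀) → ℝ} (he : BM e) (μ : Measure (ι → Ω₀)) [IsFiniteMeasure μ] :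
    Tendsto (fun S : Finset ι => ∫ ω, specInt γ Λ f (splice (S : Set ι) ω θ) * e ω ∂μ) atTop
      (𝓝 (∫ ω, specInt γm Λ f ω * e ω ∂μ)) := by
  obtain ⟨C, hC⟩ := (specInt_bm γ hl.bm Λ).2
  obtain ⟨C', hC'⟩ := he.2
  apply tendsto_integral_filter_of_dominated_convergence (fun _ => C * C')
  · refine Eventually.of_forall fun S => ?_
    exact ((isLocal_splice S θ (specInt γ Λ f)).bm.mul he).1.aestronglyMeasurable
  · refine Eventually.of_forall fun S => ae_of_all _ fun ω => ?_
    rw [norm_mul]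
    exact mul_le_mul (hC _) (hC' _) (abs_nonneg _) ((abs_nonneg _).trans (hC ω))
  · exact integrable_const _
  · exact ae_of_all _ fun ω => (hγm Λ f hl ω).mul_const _

theorem gibbs_bot_mono (hmono : MonoPreserving γ)
    (b : Ω₀) (hb : ∀ x, b ≤ x) {γm : Specification ι Ω₀}
    (hγm : IsDirLimitSpec γ γm (fun _ => b)) {μ : Measure (ι → Ω₀)}
    (hμ : IsLimitWithBoundary γ (fun _ => b) μ) {f : (ι → Ω₀) → ℝ} (hl : IsLocal f)
    (hm : Monotone f) (Λ : Finset ι) :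
    ∫ ω, specInt γm Λ f ω ∂μ = ∫ ω, f ω ∂μ := by
  have := hμ.1
  have hG : ∀ S : Finset ι, Monotone
      fun ω => specInt γ Λ f (splice (S : Set ι) ω (fun _ => b)) := fun S ω ω' h =>
    hmono Λ f hl.bm.1 hm (splice_mono _ _ h)
  apply le_antisymm
  · have h1 := dir_integral γ hγm hl Λ (e := fun _ => 1) ⟨measurable_const, 1, by simp⟩ μ
    simp only [mul_one] at h1
    refine le_of_tendsto' h1 fun S => ?_
    refine le_of_tendsto_of_tendsto (hμ.2 _ (isLocal_splice S _ (specInt γ Λ f))) (hμ.2 f hl) ?_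
    filter_upwards [eventually_ge_atTop Λ] with V hV
    rw [← specInt_consist γ hl.bm hV]
    exact specInt_mono γ (isLocal_splice S _ (specInt γ Λ f)).bm (specInt_bm γ hl.bm Λ)
      (fun ω => hmono Λ f hl.bm.1 hm (splice_bot_le b hb _ ω)) _ _
  · refine le_of_tendsto (hμ.2 f hl) ?_
    filter_upwards [eventually_ge_atTop Λ] with V hV
    rw [← specInt_consist γ hl.bm hV]
    have h1 : specInt γ V (specInt γ Λ f) (fun _ => b) =
        specInt γ V (fun ω => specInt γ Λ f (splice (V : Set ι) ω (fun _ => b))) (fun _ => b) := by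
      apply specInt_congr_out
      intro ω' h
      congr 1
      funext x
      simp only [splice]
      split_ifs with hx
      · rfl
      · exact h x (by simpa using hx)
    rw [h1]
    refine (bot_le_lim γ hmono b hb hμ (isLocal_splice V _ (specInt γ Λ f)) (hG V) V).trans ?_
    exact integral_mono ((isLocal_splice V _ (specInt γ Λ f)).bm.integrable _)
      ((specInt_bm γm hl.bm Λ).integrable _) fun ω => dir_le γ hmono b hb hγm hl hm Λ V ω

/-- upgrade of consistency from increasing local functions to all local functions -/
theorem gibbs_upgrade {γm : Specification ι Ω₀} {μ : Measure (ι → Ω₀)} [IsProbabilityMeasure μ]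
    (Λ : Finset ι)
    (H : ∀ f, IsLocal f → Monotone f → ∫ ω, specInt γm Λ f ω ∂μ = ∫ ω, f ω ∂μ)
    {f : (ι → Ω₀) → ℝ} (hl : IsLocal f) :
    ∫ ω, specInt γm Λ f ω ∂μ = ∫ ω, f ω ∂μ := by
  obtain ⟨h1, h2, l1, l2, m1, m2, rfl⟩ := local_decomp hl
  simp only [specInt_sub γm l1.bm l2.bm]
  rw [integral_sub (l1.bm.integrable _) (l2.bm.integrable _),
    integral_sub ((specInt_bm γm l1.bm Λ).integrable _) ((specInt_bm γm l2.bm Λ).integrable _),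
    H _ l1 m1, H _ l2 m2]

theorem isGibbs_of_local {γm : Specification ι Ω₀} {μ : Measure (ι → Ω₀)} [IsProbabilityMeasure μ]
    (H : ∀ Λ f, IsLocal f → ∫ ω, specInt γm Λ f ω ∂μ = ∫ ω, f ω ∂μ) : IsGibbs γm μ := by
  intro Λ
  have hp : IsProbabilityMeasure (μ.bind (kern γm Λ)) := inferInstance
  change μ.bind (kern γm Λ) = μ
  apply measure_ext_local
  intro f hf
  rw [← H Λ f hf]
  have hc : (ProbabilityTheory.Kernel.comp (kern γm Λ)
      (ProbabilityTheory.Kernel.const Unit μ)) () = μ.bind (kern γm Λ) := by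
    rw [ProbabilityTheory.Kernel.comp_apply, ProbabilityTheory.Kernel.const_apply]
  have := ProbabilityTheory.Kernel.integral_comp (κ := ProbabilityTheory.Kernel.const Unit μ)
    (η := kern γm Λ) (a := ()) (f := f) (by rw [hc]; exact hf.bm.integrable _)
  rw [hc] at this
  exact this

theorem cond_factor {A V : Finset ι} (hAV : A ⊆ V) (η θ : ι → Ω₀) {f : (ι → Ω₀) → ℝ}
    (hf : BM f) {e : (ι → Ω₀) → ℝ} (he : IsLocal e) (hed : DependsOn e (A : Set ι))
    (he0 : ∀ ω, (∃ x ∈ A, ω x ≠ η x) → e ω = 0) :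
    specInt γ V (fun ω => f ω * e ω) θ =
      specInt γ (V \ A) f (splice (A : Set ι) η θ) * specInt γ V e θ := by
  rw [← specInt_consist γ (hf.mul he.bm) (Finset.sdiff_subset : V \ A ⊆ V)]
  have h1 : ∀ ω, specInt γ (V \ A) (fun ω => f ω * e ω) ω = specInt γ (V \ A) f ω * e ω :=
    fun ω => specInt_mul γ (hed.mono (by
      intro x hx; simp at hx ⊢; intro _; exact hx)) ω
  rw [specInt_congr_out γ V θ (g := fun ω => specInt γ (V \ A) f (splice (A : Set ι) η θ) * e ω)]
  · simp only [specInt]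
    rw [integral_const_mul]
  · intro ω' hω
    rw [h1]
    by_cases hx : ∃ x ∈ A, ω' x ≠ η x
    · rw [he0 _ hx]; simp
    · push Not at hx
      congr 1
      unfold specInt
      rw [k_congr γ (V \ A)]
      intro x hxV
      simp only [splice]
      split_ifs with hA
      · exact hx x hA
      · apply hω
        simp at hxV
        intro hV
        exact hA (hxV hV)

theorem cond_dom (hmono : MonoPreserving γ)
    (b t : Ω₀) (hb : ∀ x, b ≤ x) {μm μp : Measure (ι → Ω₀)}
    (hμm : IsLimitWithBoundary γ (fun _ => b) μm) (hμp : IsLimitWithBoundary γ (fun _ => t) μp)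
    (A : Finset ι) (η : ι → Ω₀) {f : (ι → Ω₀) → ℝ}
    (hl : IsLocal f) (hm : Monotone f) {e : (ι → Ω₀) → ℝ} (hed : DependsOn e (A : Set ι))
    (he0 : ∀ ω, (∃ x ∈ A, ω x ≠ η x) → e ω = 0) (hpos : ∀ ω, 0 ≤ e ω) :
    (∫ ω, f ω * e ω ∂μm) * (∫ ω, e ω ∂μp) ≤ (∫ ω, f ω * e ω ∂μp) * (∫ ω, e ω ∂μm) := by
  have he : IsLocal e := dep_isLocal hed
  have hfe : IsLocal (fun ω => f ω * e ω) := hl.op2 he (fun a b => a * b)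
  refine le_of_tendsto_of_tendsto ((hμm.2 _ hfe).mul (hμp.2 _ he))
    ((hμp.2 _ hfe).mul (hμm.2 _ he)) ?_
  filter_upwards [eventually_ge_atTop A] with V hV
  rw [cond_factor γ hV η _ hl.bm he hed he0, cond_factor γ hV η _ hl.bm he hed he0]
  have h1 : specInt γ (V \ A) f (splice (A : Set ι) η fun _ => b) ≤
      specInt γ (V \ A) f (splice (A : Set ι) η fun _ => t) := by
    apply hmono _ f hl.bm.1 hm
    intro x
    simp only [splice]
    split_ifs
    · exact le_rfl
    · exact hb _
  have p1 : 0 ≤ specInt γ V e (fun _ => b) := integral_nonneg hpos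
  have p2 : 0 ≤ specInt γ V e (fun _ => t) := integral_nonneg hpos
  have := mul_le_mul_of_nonneg_right h1 (mul_nonneg p1 p2)
  nlinarith

theorem cond_dom_spec (hmono : MonoPreserving γ)
    (b t : Ω₀) (hb : ∀ x, b ≤ x) {μm μp : Measure (ι → Ω₀)}
    (hμm : IsLimitWithBoundary γ (fun _ => b) μm) (hμp : IsLimitWithBoundary γ (fun _ => t) μp)
    {γp : Specification ι Ω₀} (hγp : IsDirLimitSpec γ γp (fun _ => t)) (Λ : Finset ι)
    (A : Finset ι) (η : ι → Ω₀) {f : (ι → Ω₀) → ℝ}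
    (hl : IsLocal f) (hm : Monotone f) {e : (ι → Ω₀) → ℝ} (hed : DependsOn e (A : Set ι))
    (he0 : ∀ ω, (∃ x ∈ A, ω x ≠ η x) → e ω = 0) (hpos : ∀ ω, 0 ≤ e ω) :
    (∫ ω, specInt γp Λ f ω * e ω ∂μm) * (∫ ω, e ω ∂μp) ≤
      (∫ ω, specInt γp Λ f ω * e ω ∂μp) * (∫ ω, e ω ∂μm) := by
  have he : IsLocal e := dep_isLocal hed
  have := hμm.1
  have := hμp.1
  refine le_of_tendsto_of_tendsto' ((dir_integral γ hγp hl Λ he.bm μm).mul_const _)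
    ((dir_integral γ hγp hl Λ he.bm μp).mul_const _) fun S => ?_
  exact cond_dom γ hmono b t hb hμm hμp A η (isLocal_splice S _ (specInt γ Λ f))
    (fun ω ω' h => hmono Λ f hl.bm.1 hm (splice_mono _ _ h)) hed he0 hpos

end Order

section Entropy
set_option linter.unusedSectionVars false
set_option linter.style.haveILetI false
set_option linter.unusedVariables false

variable {ι Ω₀ : Type*} [MeasurableSpace Ω₀] [Fintype Ω₀] [DiscreteMeasurableSpace Ω₀]

/-- indicator of the cylinder of configurations agreeing with `η` on `A` -/
def cylI (A : Finset ι) (η ω : ι → Ω₀) : ℝ := if ∀ x ∈ A, ω x = η x then 1 else 0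

theorem cylI_dep (A : Finset ι) (η : ι → Ω₀) : DependsOn (cylI A η) (A : Set ι) := by
  intro x y h
  have : (∀ i ∈ A, x i = η i) ↔ (∀ i ∈ A, y i = η i) :=
    forall₂_congr fun i hi => by rw [h i hi]
  simp only [cylI, this]

theorem cylI_local (A : Finset ι) (η : ι → Ω₀) : IsLocal (cylI A η) := dep_isLocal (cylI_dep A η)

theorem cylI_nonneg (A : Finset ι) (η ω : ι → Ω₀) : 0 ≤ cylI A η ω := by
  unfold cylI; split_ifs <;> norm_num

theorem cylI_zero (A : Finset ι) (η ω : ι → Ω₀) (h : ∃ x ∈ A, ω x ≠ η x) : cylI A η ω = 0 := by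
  unfold cylI
  rw [if_neg]
  push Not
  exact h

theorem cylI_mul_congr {g : (ι → Ω₀) → ℝ} {A : Finset ι} (hg : DependsOn g (A : Set ι))
    (η ω : ι → Ω₀) : g ω * cylI A η ω = g η * cylI A η ω := by
  unfold cylI
  split_ifs with h
  · rw [hg h]
  · simp

/-- extension of a finite configuration -/
def extA (A : Finset ι) (b : Ω₀) (σ : A → Ω₀) : ι → Ω₀ :=
  fun x => if h : x ∈ A then σ ⟨x, h⟩ else b

theorem cylI_sum (A : Finset ι) (b : Ω₀) (ω : ι → Ω₀) :
    ∑ σ : A → Ω₀, cylI A (extA A b σ) ω = 1 := by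
  rw [Finset.sum_eq_single (fun x : A => ω x)]
  · unfold cylI extA
    rw [if_pos]
    intro x hx
    simp [hx]
  · intro σ _ hne
    apply cylI_zero
    by_contra hcon
    push Not at hcon
    apply hne
    funext x
    have := hcon x x.2
    simp [extA] at this
    exact this.symm
  · simp

theorem integral_cyl (A : Finset ι) (b : Ω₀) {h : (ι → Ω₀) → ℝ} (hh : BM h)
    (μ : Measure (ι → Ω₀)) [IsFiniteMeasure μ] :
    ∫ ω, h ω ∂μ = ∑ σ : A → Ω₀, ∫ ω, h ω * cylI A (extA A b σ) ω ∂μ := by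
  rw [← integral_finsetSum _ fun σ _ => (hh.mul (cylI_local A _).bm).integrable μ]
  congr 1
  funext ω
  rw [← Finset.mul_sum, cylI_sum, mul_one]

/-- conditional expectation on the coordinates in `A` -/
def cE (ν : Measure (ι → Ω₀)) (A : Finset ι) (f : (ι → Ω₀) → ℝ) (ω : ι → Ω₀) : ℝ :=
  (∫ x, f x * cylI A ω x ∂ν) / (∫ x, cylI A ω x ∂ν)

theorem cE_dep (ν : Measure (ι → Ω₀)) (A : Finset ι) (f : (ι → Ω₀) → ℝ) :
    DependsOn (cE ν A f) (A : Set ι) := by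
  intro x y h
  have : cylI A x = cylI A y := by
    funext ω
    have : (∀ i ∈ A, ω i = x i) ↔ (∀ i ∈ A, ω i = y i) :=
      forall₂_congr fun i hi => by rw [h i hi]
    simp only [cylI, this]
  simp only [cE, this]

theorem abs_int_cyl_le (ν : Measure (ι → Ω₀)) [IsProbabilityMeasure ν] (A : Finset ι)
    {f : (ι → Ω₀) → ℝ} {C : ℝ} (hC : ∀ ω, |f ω| ≤ C) (η : ι → Ω₀) :
    |∫ x, f x * cylI A η x ∂ν| ≤ C * ∫ x, cylI A η x ∂ν := by
  rw [← integral_const_mul]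
  rw [← Real.norm_eq_abs]
  refine norm_integral_le_of_norm_le (((cylI_local A η).bm.integrable ν).const_mul C)
    (ae_of_all _ fun ω => ?_)
  rw [Real.norm_eq_abs, abs_mul, abs_of_nonneg (cylI_nonneg A η ω)]
  exact mul_le_mul_of_nonneg_right (hC ω) (cylI_nonneg A η ω)

theorem cE_mul (ν : Measure (ι → Ω₀)) [IsProbabilityMeasure ν] (A : Finset ι)
    {f : (ι → Ω₀) → ℝ} (hf : BM f) (η : ι → Ω₀) :
    cE ν A f η * ∫ x, cylI A η x ∂ν = ∫ x, f x * cylI A η x ∂ν := by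
  unfold cE
  by_cases h : ∫ x, cylI A η x ∂ν = 0
  · obtain ⟨C, hC⟩ := hf.2
    have := abs_int_cyl_le ν A hC η
    rw [h, mul_zero] at this ⊢
    exact (abs_nonpos_iff.1 this).symm
  · field_simp

theorem cE_bound (ν : Measure (ι → Ω₀)) [IsProbabilityMeasure ν] (A : Finset ι)
    {f : (ι → Ω₀) → ℝ} (hC : ∀ ω, |f ω| ≤ 1) (η : ι → Ω₀) : |cE ν A f η| ≤ 1 := by
  have h := abs_int_cyl_le ν A hC η
  unfold cE
  rw [abs_div, one_mul] at *
  have h0 : 0 ≤ ∫ x, cylI A η x ∂ν := integral_nonneg (cylI_nonneg A η)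
  rw [abs_of_nonneg h0]
  exact div_le_one_of_le₀ h h0

theorem cE_orth (ν : Measure (ι → Ω₀)) [IsProbabilityMeasure ν] (A : Finset ι) (b : Ω₀)
    {f g : (ι → Ω₀) → ℝ} (hf : BM f) (hg : DependsOn g (A : Set ι)) :
    ∫ ω, (cE ν A f ω - f ω) * g ω ∂ν = 0 := by
  have hgl := (dep_isLocal hg).bm
  have hcl := (dep_isLocal (cE_dep ν A f)).bm
  have e1 : ∫ ω, (cE ν A f ω - f ω) * g ω ∂ν =
      ∫ ω, cE ν A f ω * g ω ∂ν - ∫ ω, f ω * g ω ∂ν := by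
    rw [← integral_sub ((hcl.mul hgl).integrable _) ((hf.mul hgl).integrable _)]
    congr 1; funext ω; ring
  rw [e1, integral_cyl A b (hcl.mul hgl) ν, integral_cyl A b (hf.mul hgl) ν, sub_eq_zero]
  refine Finset.sum_congr rfl fun σ _ => ?_
  have a1 : ∀ ω, cE ν A f ω * g ω * cylI A (extA A b σ) ω =
      cE ν A f (extA A b σ) * g (extA A b σ) * cylI A (extA A b σ) ω := fun ω => by
    have h1 := cylI_mul_congr hg (extA A b σ) ω
    have h2 := cylI_mul_congr (cE_dep ν A f) (extA A b σ) ω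
    calc _ = cE ν A f ω * (g ω * cylI A (extA A b σ) ω) := by ring
      _ = g (extA A b σ) * (cE ν A f ω * cylI A (extA A b σ) ω) := by rw [h1]; ring
      _ = _ := by rw [h2]; ring
  have a2 : ∀ ω, f ω * g ω * cylI A (extA A b σ) ω =
      g (extA A b σ) * (f ω * cylI A (extA A b σ) ω) := fun ω => by
    have h1 := cylI_mul_congr hg (extA A b σ) ω
    calc _ = f ω * (g ω * cylI A (extA A b σ) ω) := by ring
      _ = _ := by rw [h1]; ring
  simp only [a1, a2]
  rw [integral_const_mul, integral_const_mul, ← cE_mul ν A hf]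
  ring

theorem cE_ge (μ ν : Measure (ι → Ω₀)) [IsProbabilityMeasure ν] [IsProbabilityMeasure μ]
    (A : Finset ι) (b : Ω₀) {f φ : (ι → Ω₀) → ℝ} (hφ : BM φ)
    (h1 : ∀ η, (∫ x, φ x * cylI A η x ∂μ) * (∫ x, cylI A η x ∂ν) ≤
      (∫ x, f x * cylI A η x ∂ν) * (∫ x, cylI A η x ∂μ))
    (h2 : ∀ η, ∫ x, cylI A η x ∂ν = 0 → ∫ x, cylI A η x ∂μ = 0) :
    ∫ ω, φ ω ∂μ ≤ ∫ ω, cE ν A f ω ∂μ := by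
  have hcl := (dep_isLocal (cE_dep ν A f)).bm
  rw [integral_cyl A b hcl μ, integral_cyl A b hφ μ]
  refine Finset.sum_le_sum fun σ _ => ?_
  rw [integral_congr_ae (ae_of_all μ fun ω => cylI_mul_congr (cE_dep ν A f) (extA A b σ) ω),
    integral_const_mul]
  set η := extA A b σ
  rcases (integral_nonneg (cylI_nonneg A η) : 0 ≤ ∫ x, cylI A η x ∂ν).eq_or_lt with h | h
  · have hz := h2 η h.symm
    obtain ⟨C, hC⟩ := hφ.2
    have := abs_int_cyl_le μ A hC η
    rw [hz, mul_zero] at this ⊢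
    exact (abs_nonpos_iff.1 this).le
  · unfold cE
    rw [div_mul_eq_mul_div, le_div_iff₀ h]
    exact h1 η

theorem mart_step (ν : Measure (ι → Ω₀)) [IsProbabilityMeasure ν] (A : Finset ι) (b : Ω₀)
    {f F : (ι → Ω₀) → ℝ} (hf : IsLocal f) (hf1 : ∀ ω, |f ω| ≤ 1) (hF : DependsOn F (A : Set ι))
    (hexp : ∫ ω, Real.exp (F ω) ∂ν ≤ 1) {t : ℝ} (ht0 : 0 ≤ t) (ht : t ≤ 1 / 2) :
    ∫ ω, Real.exp (F ω + t * (cE ν A f ω - f ω) - 4 * t ^ 2) ∂ν ≤ 1 := by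
  have hFl : IsLocal F := dep_isLocal hF
  have hcl : IsLocal (cE ν A f) := dep_isLocal (cE_dep ν A f)
  have hD : IsLocal (fun ω => cE ν A f ω - f ω) := hcl.op2 hf (fun a b => a - b)
  have hG : DependsOn (fun ω => Real.exp (F ω - 4 * t ^ 2)) (A : Set ι) := by
    intro x y h
    simp only [hF h]
  have hGb := (dep_isLocal hG).bm
  have hexpl : IsLocal (fun ω => Real.exp (F ω + t * (cE ν A f ω - f ω) - 4 * t ^ 2)) :=
    hFl.op2 hD (fun a b => Real.exp (a + t * b - 4 * t ^ 2))
  have h1 : ∫ ω, Real.exp (F ω + t * (cE ν A f ω - f ω) - 4 * t ^ 2) ∂ν ≤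
      ∫ ω, ((1 + 4 * t ^ 2) * Real.exp (F ω - 4 * t ^ 2) +
        t * ((cE ν A f ω - f ω) * Real.exp (F ω - 4 * t ^ 2))) ∂ν := by
    refine integral_mono (hexpl.bm.integrable _) (((hGb.integrable ν).const_mul _).add
      (((hD.bm.mul hGb).integrable ν).const_mul _)) fun ω => ?_
    have hd : |cE ν A f ω - f ω| ≤ 2 := by
      have := abs_sub (cE ν A f ω) (f ω)
      have := cE_bound ν A hf1 ω
      have := hf1 ω
      linarith
    set D := cE ν A f ω - f ω
    have hD2 : D ^ 2 ≤ 4 := by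
      rw [← sq_abs]; nlinarith [abs_nonneg D]
    have hx : |t * D| ≤ 1 := by
      rw [abs_mul, abs_of_nonneg ht0]; nlinarith [abs_nonneg D]
    have h3 := (abs_le.1 (Real.abs_exp_sub_one_sub_id_le hx)).2
    have h4 : Real.exp (t * D) ≤ 1 + 4 * t ^ 2 + t * D := by nlinarith [sq_nonneg t]
    have : F ω + t * D - 4 * t ^ 2 = t * D + (F ω - 4 * t ^ 2) := by ring
    simp only [this]
    rw [Real.exp_add]
    have := mul_le_mul_of_nonneg_right h4 (Real.exp_pos (F ω - 4 * t ^ 2)).le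
    linarith
  refine h1.trans ?_
  rw [integral_add ((hGb.integrable ν).const_mul _) (((hD.bm.mul hGb).integrable ν).const_mul _),
    integral_const_mul, integral_const_mul, cE_orth ν A b hf.bm hG]
  have h5 : ∫ ω, Real.exp (F ω - 4 * t ^ 2) ∂ν =
      (∫ ω, Real.exp (F ω) ∂ν) * Real.exp (-(4 * t ^ 2)) := by
    rw [← integral_mul_const]
    congr 1; funext ω
    rw [← Real.exp_add, sub_eq_add_neg]
  rw [h5, mul_zero, add_zero]
  have h6 : (1 + 4 * t ^ 2) * Real.exp (-(4 * t ^ 2)) ≤ 1 := by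
    have := Real.add_one_le_exp (4 * t ^ 2)
    rw [Real.exp_neg, ← div_eq_mul_inv, div_le_one (Real.exp_pos _)]
    linarith
  have h7 : 0 ≤ ∫ ω, Real.exp (F ω) ∂ν := integral_nonneg fun ω => (Real.exp_pos _).le
  have h8 : 0 ≤ (1 + 4 * t ^ 2) * Real.exp (-(4 * t ^ 2)) := by positivity
  nlinarith

theorem density_dep (Δ : Finset ι) (μ ν : Measure (ι → Ω₀)) :
    DependsOn (density Δ μ ν) (Δ : Set ι) := by
  intro x y h
  have : (fun i : {i // i ∈ Δ} => x i) = fun i : {i // i ∈ Δ} => y i := by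
    funext i; exact h i i.2
  simp only [density, this]

theorem density_integral (Δ : Finset ι) (μ ν : Measure (ι → Ω₀)) [IsProbabilityMeasure ν]
    [IsProbabilityMeasure μ] (hac : restrictTo Δ μ ≪ restrictTo Δ ν) {F : (ι → Ω₀) → ℝ}
    (hF : DependsOn F (Δ : Set ι)) : ∫ ω, density Δ μ ν ω * F ω ∂ν = ∫ ω, F ω ∂μ := by
  obtain ⟨G, hG⟩ := dependsOn_iff_exists_comp.1 hF
  have hm : Measurable (fun (ω : ι → Ω₀) (x : {x // x ∈ Δ}) => ω (x : ι)) :=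
    measurable_pi_lambda _ fun i => measurable_pi_apply _
  have p1 : IsProbabilityMeasure (restrictTo Δ μ) :=
    Measure.isProbabilityMeasure_map hm.aemeasurable
  have p2 : IsProbabilityMeasure (restrictTo Δ ν) :=
    Measure.isProbabilityMeasure_map hm.aemeasurable
  have h := integral_toReal_rnDeriv_mul hac (f := (G : ({x // x ∈ Δ} → Ω₀) → ℝ))
  have hGm : Measurable (G : ({x // x ∈ Δ} → Ω₀) → ℝ) := measurable_of_finite _
  unfold restrictTo at h
  rw [integral_map hm.aemeasurable, integral_map hm.aemeasurable] at h
  · rw [hG]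
    exact h
  · exact hGm.aestronglyMeasurable
  · exact (measurable_of_finite _).aestronglyMeasurable

theorem donsker (Δ : Finset ι) (μ ν : Measure (ι → Ω₀)) [IsProbabilityMeasure ν]
    [IsProbabilityMeasure μ] (hac : restrictTo Δ μ ≪ restrictTo Δ ν) {F : (ι → Ω₀) → ℝ}
    (hF : DependsOn F (Δ : Set ι)) (hexp : ∫ ω, Real.exp (F ω) ∂ν ≤ 1) :
    ∫ ω, F ω ∂μ ≤ ∫ ω, density Δ μ ν ω * Real.log (density Δ μ ν ω) ∂ν := by
  have hr := dep_isLocal (density_dep Δ μ ν)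
  have hFl := dep_isLocal hF
  rw [← density_integral Δ μ ν hac hF]
  have h1 := density_integral Δ μ ν hac (F := fun _ => (1 : ℝ)) (fun _ _ _ => rfl)
  simp only [mul_one, integral_const, probReal_univ, smul_eq_mul] at h1
  have i1 : IsLocal (fun ω => density Δ μ ν ω * F ω) := hr.op2 hFl (fun a b => a * b)
  have i2 : IsLocal (fun ω => density Δ μ ν ω * Real.log (density Δ μ ν ω)) :=
    hr.op2 hr (fun a b => a * Real.log b)
  have i3 : IsLocal (fun ω => Real.exp (F ω)) := hFl.op2 hFl (fun a b => Real.exp a)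
  have key : ∫ ω, density Δ μ ν ω * F ω ∂ν ≤
      ∫ ω, ((density Δ μ ν ω * Real.log (density Δ μ ν ω) - density Δ μ ν ω)
        + Real.exp (F ω)) ∂ν := by
    refine integral_mono (i1.bm.integrable _) (((i2.bm.integrable _).sub
      (hr.bm.integrable _)).add (i3.bm.integrable _)) fun ω => ?_
    have hr0 : 0 ≤ density Δ μ ν ω := ENNReal.toReal_nonneg
    simp only
    rcases hr0.eq_or_lt with h | h
    · rw [← h]; simp [(Real.exp_pos _).le]
    · have := Real.add_one_le_exp (F ω - Real.log (density Δ μ ν ω))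
      rw [Real.exp_sub, Real.exp_log h, le_div_iff₀ h] at this
      nlinarith
  have hs : Integrable (fun ω => density Δ μ ν ω * Real.log (density Δ μ ν ω) - density Δ μ ν ω) ν :=
    (i2.bm.integrable _).sub (hr.bm.integrable _)
  rw [integral_add hs (i3.bm.integrable _),
    integral_sub (i2.bm.integrable _) (hr.bm.integrable _), h1] at key
  linarith

theorem cyl_null (Δ A : Finset ι) (hA : A ⊆ Δ) (μ ν : Measure (ι → Ω₀)) [IsProbabilityMeasure ν]
    [IsProbabilityMeasure μ] (hac : restrictTo Δ μ ≪ restrictTo Δ ν) (η : ι → Ω₀)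
    (h : ∫ x, cylI A η x ∂ν = 0) : ∫ x, cylI A η x ∂μ = 0 := by
  have hd : DependsOn (cylI A η) (Δ : Set ι) := (cylI_dep A η).mono (by exact_mod_cast hA)
  rw [← density_integral Δ μ ν hac hd]
  have := (integral_eq_zero_iff_of_nonneg (cylI_nonneg A η) ((cylI_local A η).bm.integrable ν)).1 h
  apply integral_eq_zero_of_ae
  filter_upwards [this] with ω hω
  rw [hω]; simp

theorem mart_build {J : Type*} (μ ν : Measure (ι → Ω₀)) [IsProbabilityMeasure ν]
    [IsProbabilityMeasure μ] (b : Ω₀) (Δ : Finset ι) (B : J → Finset ι)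
    (f : J → (ι → Ω₀) → ℝ) (hf : ∀ j, DependsOn (f j) (B j : Set ι)) (hf1 : ∀ j ω, |f j ω| ≤ 1)
    (hdisj : ∀ i j, i ≠ j → Disjoint (B i) (B j)) (e : ℝ)
    (he : ∀ j (A : Finset ι), Disjoint A (B j) → A ⊆ Δ →
      e ≤ ∫ ω, cE ν A (f j) ω ∂μ - ∫ ω, f j ω ∂μ)
    {t : ℝ} (ht0 : 0 ≤ t) (ht : t ≤ 1 / 2) (Z : Finset J) (hZ : ∀ j ∈ Z, B j ⊆ Δ) :
    ∃ F, DependsOn F ((Z.biUnion B : Finset ι) : Set ι) ∧ ∫ ω, Real.exp (F ω) ∂ν ≤ 1 ∧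
      (Z.card : ℝ) * (t * e - 4 * t ^ 2) ≤ ∫ ω, F ω ∂μ := by
  induction Z using Finset.induction_on with
  | empty => exact ⟨fun _ => 0, fun _ _ _ => rfl, by simp, by simp⟩
  | insert j Z hj ih =>
    obtain ⟨F, hF, hexp, hle⟩ := ih fun i hi => hZ i (Finset.mem_insert_of_mem hi)
    set A := Z.biUnion B with hA
    have hAd : Disjoint A (B j) := by
      rw [hA, Finset.disjoint_biUnion_left]
      intro i hi
      exact hdisj i j (by rintro rfl; exact hj hi)
    have hAΔ : A ⊆ Δ := by
      rw [hA, Finset.biUnion_subset]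
      exact fun i hi => hZ i (Finset.mem_insert_of_mem hi)
    have hfl := dep_isLocal (hf j)
    have hFl := dep_isLocal hF
    have hcl := dep_isLocal (cE_dep ν A (f j))
    refine ⟨fun ω => F ω + t * (cE ν A (f j) ω - f j ω) - 4 * t ^ 2, ?_,
      mart_step ν A b hfl (hf1 j) hF hexp ht0 ht, ?_⟩
    · intro x y hxy
      have h1 : ∀ i ∈ (A : Set ι), x i = y i := fun i hi => hxy i (by
        simp only [Finset.biUnion_insert, Finset.coe_union]; exact Or.inr hi)
      have h2 : ∀ i ∈ (B j : Set ι), x i = y i := fun i hi => hxy i (by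
        simp only [Finset.biUnion_insert, Finset.coe_union]; exact Or.inl hi)
      have a1 : F x = F y := hF h1
      have a2 : f j x = f j y := hf j h2
      have a3 : cE ν A (f j) x = cE ν A (f j) y := cE_dep ν A (f j) h1
      simp only [a1, a2, a3]
    · have hcf : Integrable (fun ω => cE ν A (f j) ω - f j ω) μ :=
        (hcl.bm.integrable _).sub (hfl.bm.integrable _)
      have hs : Integrable (fun ω => F ω + t * (cE ν A (f j) ω - f j ω)) μ :=
        (hFl.bm.integrable _).add (hcf.const_mul t)
      simp only []
      rw [integral_sub hs (integrable_const _),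
        integral_add (hFl.bm.integrable _) (hcf.const_mul t), integral_const_mul,
        integral_sub (hcl.bm.integrable _) (hfl.bm.integrable _), Finset.card_insert_of_notMem hj]
      have := mul_le_mul_of_nonneg_left (he j A hAd hAΔ) ht0
      simp only [integral_const, probReal_univ, smul_eq_mul, one_mul]
      push_cast
      linarith

end Entropy

section Dual
set_option linter.unusedSectionVars false
set_option linter.unusedVariables false

/-- the dual order -/
abbrev dualPO (Ω₀ : Type*) [P : PartialOrder Ω₀] : PartialOrder Ω₀ where
  le a b := P.le b a
  lt a b := P.lt b a
  lt_iff_le_not_ge a b := P.lt_iff_le_not_ge b a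
  le_refl a := P.le_refl a
  le_trans a b c h1 h2 := P.le_trans c b a h2 h1
  le_antisymm a b h1 h2 := P.le_antisymm a b h2 h1

variable {ι Ω₀ : Type*} [MeasurableSpace Ω₀] [Fintype Ω₀] [DiscreteMeasurableSpace Ω₀]
  [Countable ι]

theorem mono_dual [P : PartialOrder Ω₀] (γ : Specification ι Ω₀) (hmono : MonoPreserving γ) :
    @MonoPreserving ι Ω₀ _ (dualPO Ω₀).toPreorder γ := by
  intro Λ f hf hm
  have h1 : Monotone (fun ω => - f ω) := by
    intro x y hxy
    exact neg_le_neg (hm (a := y) (b := x) hxy)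
  have h2 := hmono Λ _ hf.neg h1
  intro x y hxy
  have h3 := h2 (a := y) (b := x) hxy
  have h4 : ∀ ω, specInt γ Λ (-f) ω = - specInt γ Λ f ω := fun ω => by
    simp only [specInt, Pi.neg_apply]
    exact integral_neg f
  rw [h4, h4] at h3
  exact neg_le_neg_iff.1 h3

theorem gibbs_local [P : PartialOrder Ω₀] (γ : Specification ι Ω₀) (hmono : MonoPreserving γ)
    (b : Ω₀) (hb : ∀ x, b ≤ x) {γm : Specification ι Ω₀}
    (hγm : IsDirLimitSpec γ γm (fun _ => b)) {μ : Measure (ι → Ω₀)}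
    (hμ : IsLimitWithBoundary γ (fun _ => b) μ) (Λ : Finset ι) {f : (ι → Ω₀) → ℝ}
    (hl : IsLocal f) : ∫ ω, specInt γm Λ f ω ∂μ = ∫ ω, f ω ∂μ := by
  have := hμ.1
  exact gibbs_upgrade Λ (fun g hg hm => gibbs_bot_mono γ hmono b hb hγm hμ hg hm Λ) hl

theorem gibbs_local_top [P : PartialOrder Ω₀] (γ : Specification ι Ω₀) (hmono : MonoPreserving γ)
    (t : Ω₀) (ht : ∀ x, x ≤ t) {γp : Specification ι Ω₀}
    (hγp : IsDirLimitSpec γ γp (fun _ => t)) {μ : Measure (ι → Ω₀)}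
    (hμ : IsLimitWithBoundary γ (fun _ => t) μ) (Λ : Finset ι) {f : (ι → Ω₀) → ℝ}
    (hl : IsLocal f) : ∫ ω, specInt γp Λ f ω ∂μ = ∫ ω, f ω ∂μ :=
  @gibbs_local ι Ω₀ _ _ _ _ (dualPO Ω₀) γ (mono_dual γ hmono) t ht γp hγp μ hμ Λ f hl

theorem step_ge [P : PartialOrder Ω₀] (γ : Specification ι Ω₀) (hmono : MonoPreserving γ)
    (b t : Ω₀) (hb : ∀ x, b ≤ x) (ht : ∀ x, x ≤ t) {γp : Specification ι Ω₀}
    (hγp : IsDirLimitSpec γ γp (fun _ => t)) {μm μp : Measure (ι → Ω₀)}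
    (hμm : IsLimitWithBoundary γ (fun _ => b) μm)
    (hμp : IsLimitWithBoundary γ (fun _ => t) μp) (Λ : Finset ι) {f : (ι → Ω₀) → ℝ}
    (hl : IsLocal f) (hm : Monotone f) (A Δ : Finset ι) (hA : Disjoint A Λ) (hAΔ : A ⊆ Δ)
    (hac : restrictTo Δ μm ≪ restrictTo Δ μp) :
    ∫ ω, specInt γp Λ f ω ∂μm ≤ ∫ ω, cE μp A f ω ∂μm := by
  have := hμm.1
  have := hμp.1
  refine cE_ge μm μp A b (specInt_bm γp hl.bm Λ) (fun η => ?_)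
    fun η => cyl_null Δ A hAΔ μm μp hac η
  have h := cond_dom_spec γ hmono b t hb hμm hμp hγp Λ A η hl hm (cylI_dep A η) (cylI_zero A η)
    (cylI_nonneg A η)
  have h2 := gibbs_local_top γ hmono t ht hγp hμp Λ (hl.op2 (cylI_local A η) (fun a b => a * b))
  have hd : DependsOn (cylI A η) ((Λ : Set ι)ᶜ) := (cylI_dep A η).mono (by
    intro x hx hx'
    exact Finset.disjoint_left.1 hA hx hx')
  simp only [specInt_mul γp hd] at h2
  rw [h2] at h
  exact h

end Dual

section Translation
set_option linter.unusedSectionVars false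
set_option linter.unusedVariables false
variable {Ω₀ : Type*} [MeasurableSpace Ω₀] [Fintype Ω₀] [DiscreteMeasurableSpace Ω₀] {d : ℕ}

theorem shift_meas (z : Site d) : Measurable (shift z : (Site d → Ω₀) → _) :=
  measurable_pi_lambda _ fun i => measurable_pi_apply _

theorem specInt_shift (γ : Specification (Site d) Ω₀) (hTI : TransInvSpec γ) (z : Site d)
    (Λ : Finset (Site d)) {f : (Site d → Ω₀) → ℝ} (hf : Measurable f) (ω : Site d → Ω₀) :
    specInt γ (Λ.image (· + z)) f (shift z ω) = specInt γ Λ (fun x => f (shift z x)) ω := by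
  unfold specInt
  rw [hTI z Λ ω, integral_map (shift_meas z).aemeasurable hf.aestronglyMeasurable]

theorem image_tendsto (z : Site d) :
    Tendsto (fun S : Finset (Site d) => S.image (· + z)) atTop atTop := by
  refine tendsto_atTop.2 fun S => ?_
  filter_upwards [eventually_ge_atTop (S.image (· - z))] with S' hS' x hx
  have := hS' (Finset.mem_image_of_mem (· - z) hx)
  exact Finset.mem_image.2 ⟨x - z, this, by simp⟩

theorem shift_dep (z : Site d) {f : (Site d → Ω₀) → ℝ} {B : Finset (Site d)}
    (h : DependsOn f (B : Set (Site d))) :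
    DependsOn (fun x => f (shift (-z) x)) ((B.image (· + z) : Finset (Site d)) : Set (Site d)) := by
  intro x y hxy
  apply h
  intro i hi
  simp only [shift]
  apply hxy
  simp only [Finset.coe_image]
  exact ⟨i, hi, (sub_neg_eq_add i z).symm⟩

theorem shift_local (z : Site d) {f : (Site d → Ω₀) → ℝ} (h : IsLocal f) :
    IsLocal (fun x => f (shift z x)) := by
  obtain ⟨Δ, hΔ⟩ := isLocal_dep h
  have := dep_isLocal (shift_dep (-z) hΔ)
  simpa using this

theorem specInt_dir_shift (γ : Specification (Site d) Ω₀) (hTI : TransInvSpec γ)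
    {γp : Specification (Site d) Ω₀} (t : Ω₀) (hγp : IsDirLimitSpec γ γp (fun _ => t)) (z : Site d)
    (Λ : Finset (Site d)) {f : (Site d → Ω₀) → ℝ} (hf : IsLocal f) (ω : Site d → Ω₀) :
    specInt γp (Λ.image (· + z)) f (shift z ω) = specInt γp Λ (fun x => f (shift z x)) ω := by
  refine tendsto_nhds_unique ((hγp (Λ.image (· + z)) f hf (shift z ω)).comp (image_tendsto z)) ?_
  refine (hγp Λ _ (shift_local z hf) ω).congr fun S => ?_
  rw [← specInt_shift γ hTI z Λ hf.bm.1]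
  simp only [Function.comp]
  congr 1
  funext x
  simp only [shift, splice, Finset.mem_coe, Finset.mem_image]
  have : (∃ a ∈ S, a + z = x) ↔ x - z ∈ S :=
    ⟨by rintro ⟨a, ha, rfl⟩; simpa using ha, fun h => ⟨_, h, by simp⟩⟩
  simp only [this]

theorem lim_shift (γ : Specification (Site d) Ω₀) (hTI : TransInvSpec γ)
    (t : Ω₀) {μ : Measure (Site d → Ω₀)} (hμ : IsLimitWithBoundary γ (fun _ => t) μ) (z : Site d)
    {g : (Site d → Ω₀) → ℝ} (hg : BM g) : ∫ ω, g (shift z ω) ∂μ = ∫ ω, g ω ∂μ := by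
  have := hμ.1
  have hp : IsProbabilityMeasure (μ.map (shift z)) :=
    Measure.isProbabilityMeasure_map (shift_meas z).aemeasurable
  have key : μ.map (shift z) = μ := by
    apply measure_ext_local
    intro f hf
    rw [integral_map (shift_meas z).aemeasurable hf.bm.1.aestronglyMeasurable]
    refine tendsto_nhds_unique (hμ.2 _ (shift_local z hf))
      (((hμ.2 f hf).comp (image_tendsto z)).congr fun Λ => ?_)
    exact specInt_shift γ hTI z Λ hf.bm.1 (fun _ => t)
  conv_rhs => rw [← key]
  rw [integral_map (shift_meas z).aemeasurable hg.1.aestronglyMeasurable]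

end Translation

section Core
set_option linter.unusedSectionVars false
set_option linter.unusedVariables false
variable {Ω₀ : Type*} [MeasurableSpace Ω₀] [Fintype Ω₀] [DiscreteMeasurableSpace Ω₀] {d : ℕ}

theorem mem_cube {n : ℕ} {x : Site d} : x ∈ cube d n ↔ ∀ k, -(n : ℤ) ≤ x k ∧ x k ≤ n := by
  simp [cube]

theorem card_cube (n : ℕ) : (cube d n).card = (2 * n + 1) ^ d := by
  simp only [cube, Fintype.card_piFinset, Int.card_Icc, Finset.prod_const, Finset.card_univ,
    Fintype.card_fin]
  congr 1
  omega

theorem exists_cube (S : Finset (Site d)) : ∃ M, S ⊆ cube d M := by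
  refine ⟨S.sup fun x => Finset.univ.sup fun k => (x k).natAbs, fun x hx => mem_cube.2 fun k => ?_⟩
  have h1 : (x k).natAbs ≤ Finset.univ.sup fun k => (x k).natAbs :=
    Finset.le_sup (f := fun k => (x k).natAbs) (Finset.mem_univ k)
  have h2 := Finset.le_sup (f := fun x : Site d => Finset.univ.sup fun k => (x k).natAbs) hx
  have h3 := h1.trans h2
  omega

/-- centre of the block with index `j` -/
def ctr (M : ℕ) (j : Site d) : Site d := fun k => (2 * M + 1) * j k

theorem block_disj (M : ℕ) (i j : Site d) (h : i ≠ j) :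
    Disjoint ((cube d M).image (· + ctr M i)) ((cube d M).image (· + ctr M j)) := by
  rw [Finset.disjoint_left]
  intro x hx hy
  obtain ⟨a, ha, rfl⟩ := Finset.mem_image.1 hx
  obtain ⟨c, hc, hca⟩ := Finset.mem_image.1 hy
  apply h
  funext k
  have h1 := mem_cube.1 ha k
  have h2 := mem_cube.1 hc k
  have h3 := congrFun hca k
  simp only [Pi.add_apply, ctr] at h3
  by_contra hne
  rcases lt_or_gt_of_ne hne with h4 | h4
  · have : i k + 1 ≤ j k := h4
    nlinarith
  · have : j k + 1 ≤ i k := h4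
    nlinarith

theorem block_sub (M m : ℕ) (j : Site d) (hj : j ∈ cube d m) :
    (cube d M).image (· + ctr M j) ⊆ cube d ((2 * M + 1) * m + M) := by
  intro x hx
  obtain ⟨a, ha, rfl⟩ := Finset.mem_image.1 hx
  refine mem_cube.2 fun k => ?_
  have h1 := mem_cube.1 ha k
  have h2 := mem_cube.1 hj k
  simp only [Pi.add_apply, ctr]
  push_cast
  constructor <;> nlinarith

theorem core_ineq [P : PartialOrder Ω₀] (γ : Specification (Site d) Ω₀) (hTI : TransInvSpec γ)
    (hmono : MonoPreserving γ)
    (b t : Ω₀) (hb : ∀ x, b ≤ x) (ht : ∀ x, x ≤ t) {γp : Specification (Site d) Ω₀}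
    (hγp : IsDirLimitSpec γ γp (fun _ => t)) {μm μp : Measure (Site d → Ω₀)}
    (hμm : IsLimitWithBoundary γ (fun _ => b) μm)
    (hμp : IsLimitWithBoundary γ (fun _ => t) μp) (hent : EntDensityZero μm μp)
    (Λ : Finset (Site d)) {f : (Site d → Ω₀) → ℝ}
    (hl : IsLocal f) (hm : Monotone f) (hf1 : ∀ ω, |f ω| ≤ 1) :
    ∫ ω, specInt γp Λ f ω ∂μm ≤ ∫ ω, f ω ∂μm := by
  have := hμm.1
  have := hμp.1
  obtain ⟨Δ₀, hΔ₀⟩ := isLocal_dep hl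
  obtain ⟨M, hM⟩ := exists_cube (Δ₀ ∪ Λ)
  have hfB : DependsOn f (cube d M : Set (Site d)) := hΔ₀.mono (by
    exact_mod_cast Finset.union_subset_left hM)
  have hΛB : Λ ⊆ cube d M := Finset.union_subset_right hM
  set e : ℝ := ∫ ω, specInt γp Λ f ω ∂μm - ∫ ω, f ω ∂μm with he_def
  have claim : ∀ s : ℝ, 0 ≤ s → s ≤ 1 / 2 → s * e - 4 * s ^ 2 ≤ 0 := by
    intro s hs0 hs
    have hBpos : (0 : ℝ) < (cube d M).card := by
      rw [card_cube]; positivity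
    set c : ℝ := (s * e - 4 * s ^ 2) / (cube d M).card with hc
    have hN : Tendsto (fun m : ℕ => (2 * M + 1) * m + M) atTop atTop := by
      refine tendsto_atTop_mono (fun m => ?_) tendsto_id
      simp only [id]
      nlinarith
    have hlim : ENNReal.ofReal c ≤ 0 := by
      refine ge_of_tendsto (hent.comp hN) (Eventually.of_forall fun m => ?_)
      simp only [Function.comp]
      set Δ := cube d ((2 * M + 1) * m + M) with hΔ
      have hcard : (Δ.card : ℝ) = (cube d m).card * (cube d M).card := by
        rw [hΔ, card_cube, card_cube, card_cube]
        push_cast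
        rw [← mul_pow]
        congr 1
        ring
      have hΔpos : Δ.card ≠ 0 := by rw [hΔ, card_cube]; positivity
      unfold relEnt
      split_ifs with hac
      · have hstep : ∀ j (A : Finset (Site d)), Disjoint A ((cube d M).image (· + ctr M j)) →
            A ⊆ Δ → e ≤ ∫ ω, cE μp A (fun x => f (shift (-ctr M j) x)) ω ∂μm -
              ∫ ω, f (shift (-ctr M j) ω) ∂μm := by
          intro j A hA hAΔ
          have hA' : Disjoint A (Λ.image (· + ctr M j)) :=
            hA.mono_right (Finset.image_subset_image hΛB)
          have hfl : IsLocal (fun x => f (shift (-ctr M j) x)) := shift_local _ hl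
          have h1 := step_ge γ hmono b t hb ht hγp hμm hμp (Λ.image (· + ctr M j)) hfl
            (fun x y hxy => hm fun k => hxy _) A Δ hA' hAΔ hac
          rw [lim_shift γ hTI b hμm _ hl.bm]
          rw [← lim_shift γ hTI b hμm (ctr M j) (specInt_bm γp hfl.bm _)] at h1
          simp only [specInt_dir_shift γ hTI t hγp (ctr M j) Λ hfl] at h1
          have h2 : ∀ x : Site d → Ω₀, shift (-ctr M j) (shift (ctr M j) x) = x := by
            intro x; funext k; simp [shift]
          simp only [h2] at h1
          rw [he_def]
          linarith
        obtain ⟨F, hF, hexp, hle⟩ := mart_build μm μp b Δ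
          (fun j => (cube d M).image (· + ctr M j)) (fun j x => f (shift (-ctr M j) x))
          (fun j => shift_dep _ hfB) (fun j ω => hf1 _) (block_disj M) e hstep hs0 hs
          (cube d m) (block_sub M m)
        have hF' : DependsOn F (Δ : Set (Site d)) := hF.mono (by
          intro x hx
          simp only [Finset.mem_coe, Finset.mem_biUnion] at hx
          obtain ⟨j, hj, hxj⟩ := hx
          exact block_sub M m j hj hxj)
        have hD := hle.trans (donsker Δ μm μp hac hF' hexp)
        rw [ENNReal.le_div_iff_mul_le (Or.inl (by exact_mod_cast hΔpos))
          (Or.inl (ENNReal.natCast_ne_top _)), ← ENNReal.ofReal_natCast,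
          ← ENNReal.ofReal_mul' (by positivity)]
        apply ENNReal.ofReal_le_ofReal
        rw [hcard, hc]
        refine le_trans (le_of_eq ?_) hD
        field_simp
      · rw [ENNReal.top_div_of_ne_top (ENNReal.natCast_ne_top _)]
        exact le_top
    have hc0 : c ≤ 0 := by simpa using hlim
    by_contra hcon
    push Not at hcon
    exact absurd (div_pos hcon hBpos) (not_lt.2 hc0)
  by_contra hcon
  push Not at hcon
  have he : 0 < e := by rw [he_def]; linarith
  have h1 := claim (min (1 / 2) (e / 8)) (by positivity) (min_le_left _ _)
  have h2 : 0 < min (1 / 2) (e / 8) := by positivity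
  have h3 : min (1 / 2) (e / 8) ≤ e / 8 := min_le_right _ _
  nlinarith

theorem core_ineq' [P : PartialOrder Ω₀] (γ : Specification (Site d) Ω₀) (hTI : TransInvSpec γ)
    (hmono : MonoPreserving γ)
    (b t : Ω₀) (hb : ∀ x, b ≤ x) (ht : ∀ x, x ≤ t) {γp : Specification (Site d) Ω₀}
    (hγp : IsDirLimitSpec γ γp (fun _ => t)) {μm μp : Measure (Site d → Ω₀)}
    (hμm : IsLimitWithBoundary γ (fun _ => b) μm)
    (hμp : IsLimitWithBoundary γ (fun _ => t) μp) (hent : EntDensityZero μm μp)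
    (Λ : Finset (Site d)) {f : (Site d → Ω₀) → ℝ}
    (hl : IsLocal f) (hm : Monotone f) :
    ∫ ω, specInt γp Λ f ω ∂μm ≤ ∫ ω, f ω ∂μm := by
  obtain ⟨C, hC⟩ := hl.bm.2
  have hC0 : 0 ≤ C := (abs_nonneg _).trans (hC (fun _ => b))
  have hC1 : 0 < C + 1 := by linarith
  have h := core_ineq γ hTI hmono b t hb ht hγp hμm hμp hent Λ
    (f := fun ω => (C + 1)⁻¹ * f ω) (hl.op2 hl (fun a _ => (C + 1)⁻¹ * a))
    (fun x y hxy => mul_le_mul_of_nonneg_left (hm hxy) (by positivity)) (fun ω => by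
      rw [abs_mul, abs_of_pos (inv_pos.2 hC1), inv_mul_le_one₀ hC1]
      have := hC ω
      linarith)
  have h2 : ∀ ω, specInt γp Λ (fun ω => (C + 1)⁻¹ * f ω) ω = (C + 1)⁻¹ * specInt γp Λ f ω :=
    fun ω => integral_const_mul _ _
  simp only [h2] at h
  rw [integral_const_mul, integral_const_mul] at h
  exact le_of_mul_le_mul_left h (inv_pos.2 hC1)

variable [TopologicalSpace Ω₀] [DiscreteTopology Ω₀]

theorem local_cont {ι : Type*} {f : (ι → Ω₀) → ℝ} (h : IsLocal f) : Continuous f := by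
  obtain ⟨Δ, hΔ⟩ := isLocal_dep h
  obtain ⟨g, rfl⟩ := dependsOn_iff_exists_comp.1 hΔ
  have hg : Continuous g := continuous_of_discreteTopology
  exact hg.comp (continuous_pi fun i => continuous_apply _)

theorem sandwich_cont {ι : Type*} {g : (ι → Ω₀) → ℝ} {L U : Finset ι → (ι → Ω₀) → ℝ}
    (hL : ∀ S, IsLocal (L S)) (hU : ∀ S, IsLocal (U S)) (h1 : ∀ S ω, L S ω ≤ g ω)
    (h2 : ∀ S ω, g ω ≤ U S ω) (ω : ι → Ω₀) (h3 : Tendsto (fun S => L S ω) atTop (𝓝 (g ω)))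
    (h4 : Tendsto (fun S => U S ω) atTop (𝓝 (g ω))) : ContinuousAt g ω := by
  refine tendsto_order.2 ⟨fun a ha => ?_, fun a ha => ?_⟩
  · obtain ⟨S, hS⟩ := (h3.eventually_const_lt ha).exists
    filter_upwards [(local_cont (hL S)).continuousAt.eventually_const_lt hS] with ω' h'
    exact h'.trans_le (h1 S ω')
  · obtain ⟨S, hS⟩ := (h4.eventually_lt_const ha).exists
    filter_upwards [(local_cont (hU S)).continuousAt.eventually_lt_const hS] with ω' h'
    exact (h2 S ω').trans_lt h'

theorem dir_ge [P : PartialOrder Ω₀] (γ : Specification (Site d) Ω₀) (hmono : MonoPreserving γ)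
    (t : Ω₀) (ht : ∀ x, x ≤ t) {γp : Specification (Site d) Ω₀}
    (hγp : IsDirLimitSpec γ γp (fun _ => t)) {f : (Site d → Ω₀) → ℝ} (hl : IsLocal f)
    (hm : Monotone f) (Λ S : Finset (Site d)) (ω : Site d → Ω₀) :
    specInt γp Λ f ω ≤ specInt γ Λ f (splice (S : Set (Site d)) ω (fun _ => t)) := by
  apply le_of_tendsto (hγp Λ f hl ω)
  filter_upwards [eventually_ge_atTop S] with V' hV
  apply hmono Λ f hl.bm.1 hm
  intro x
  simp only [splice]
  split_ifs with h1 h2 h2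
  · exact le_rfl
  · exact ht _
  · exact absurd (hV h2) h1
  · exact le_rfl

theorem core_main [P : PartialOrder Ω₀] (γ : Specification (Site d) Ω₀) (hTI : TransInvSpec γ)
    (hmono : MonoPreserving γ)
    (b t : Ω₀) (hb : ∀ x, b ≤ x) (ht : ∀ x, x ≤ t) {γp γm : Specification (Site d) Ω₀}
    (hγp : IsDirLimitSpec γ γp (fun _ => t)) (hγm : IsDirLimitSpec γ γm (fun _ => b))
    {μm μp : Measure (Site d → Ω₀)}
    (hμm : IsLimitWithBoundary γ (fun _ => b) μm)
    (hμp : IsLimitWithBoundary γ (fun _ => t) μp) (hent : EntDensityZero μm μp) :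
    IsGibbs γp μm ∧ μm (contSet γp) = 1 ∧ μm (contSet γm) = 1 ∧ AlmostQuasilocal μm := by
  have := hμm.1
  have hle := fun Λ f hl hm ω => dir_bot_le_top γ hmono b t hb hγm hγp (f := f) hl hm Λ ω
  have heq : ∀ Λ f, IsLocal f → Monotone f →
      ∫ ω, specInt γm Λ f ω ∂μm = ∫ ω, f ω ∂μm ∧ ∫ ω, specInt γp Λ f ω ∂μm = ∫ ω, f ω ∂μm := by
    intro Λ f hl hm
    have h1 := gibbs_local γ hmono b hb hγm hμm Λ hl
    refine ⟨h1, le_antisymm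
      (core_ineq' γ hTI hmono b t hb ht hγp hμm hμp hent Λ hl hm) ?_⟩
    rw [← h1]
    exact integral_mono ((specInt_bm γm hl.bm Λ).integrable _)
      ((specInt_bm γp hl.bm Λ).integrable _) (hle Λ f hl hm)
  have hG : IsGibbs γp μm := isGibbs_of_local fun Λ f hl =>
    gibbs_upgrade Λ (fun g hg hm => (heq Λ g hg hm).2) hl
  have hae1 : ∀ Λ f, IsLocal f → Monotone f →
      ∀ᵐ ω ∂μm, specInt γm Λ f ω = specInt γp Λ f ω := by
    intro Λ f hl hm
    have h := (integral_eq_iff_of_ae_le ((specInt_bm γm hl.bm Λ).integrable μm)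
      ((specInt_bm γp hl.bm Λ).integrable μm) (ae_of_all _ (hle Λ f hl hm))).1
      ((heq Λ f hl hm).1.trans (heq Λ f hl hm).2.symm)
    exact h
  have hae2 : ∀ Λ f, IsLocal f → ∀ᵐ ω ∂μm, specInt γm Λ f ω = specInt γp Λ f ω := by
    intro Λ f hl
    obtain ⟨h1, h2, l1, l2, m1, m2, rfl⟩ := local_decomp hl
    filter_upwards [hae1 Λ h1 l1 m1, hae1 Λ h2 l2 m2] with ω e1 e2
    rw [specInt_sub γm l1.bm l2.bm, specInt_sub γp l1.bm l2.bm, e1, e2]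
  have hae3 : ∀ᵐ ω ∂μm, ∀ (Λ : Finset (Site d)) (q : Σ A : Finset (Site d), (A → Ω₀)),
      specInt γm Λ (cylI q.1 (extA q.1 b q.2)) ω = specInt γp Λ (cylI q.1 (extA q.1 b q.2)) ω := by
    rw [ae_all_iff]; intro Λ
    rw [ae_all_iff]; intro q
    exact hae2 Λ _ (cylI_local _ _)
  have hae4 : ∀ᵐ ω ∂μm, ∀ Λ f, IsLocal f → specInt γm Λ f ω = specInt γp Λ f ω := by
    filter_upwards [hae3] with ω hω Λ f hl
    have := γm.isProb Λ ω
    have := γp.isProb Λ ω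
    obtain ⟨A, hA⟩ := isLocal_dep hl
    unfold specInt
    rw [integral_cyl A b hl.bm, integral_cyl A b hl.bm]
    refine Finset.sum_congr rfl fun σ _ => ?_
    simp only [fun x => cylI_mul_congr hA (extA A b σ) x]
    rw [integral_const_mul, integral_const_mul]
    congr 1
    exact hω Λ ⟨A, σ⟩
  have hcont : ∀ ω, (∀ Λ f, IsLocal f → specInt γm Λ f ω = specInt γp Λ f ω) →
      ω ∈ contSet γp ∧ ω ∈ contSet γm := by
    intro ω hω
    have hc : ∀ Λ f, IsLocal f → Monotone f →
        ContinuousAt (specInt γp Λ f) ω ∧ ContinuousAt (specInt γm Λ f) ω := by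
      intro Λ f hl hm
      have hL := fun S ω => dir_le γ hmono b hb hγm hl hm Λ S ω
      have hU := fun S ω => dir_ge γ hmono t ht hγp hl hm Λ S ω
      have l1 := fun S : Finset (Site d) => isLocal_splice S (fun _ => b) (specInt γ Λ f)
      have l2 := fun S : Finset (Site d) => isLocal_splice S (fun _ => t) (specInt γ Λ f)
      have t1 := hγm Λ f hl ω
      have t2 := hγp Λ f hl ω
      constructor
      · exact sandwich_cont l1 l2 (fun S ω => (hL S ω).trans (hle Λ f hl hm ω)) hU ω
          (hω Λ f hl ▸ t1) t2
      · exact sandwich_cont l1 l2 hL (fun S ω => (hle Λ f hl hm ω).trans (hU S ω)) ω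
          t1 (by rw [hω Λ f hl]; exact t2)
    have hc2 : ∀ Λ f, IsLocal f →
        ContinuousAt (specInt γp Λ f) ω ∧ ContinuousAt (specInt γm Λ f) ω := by
      intro Λ f hl
      obtain ⟨h1, h2, l1, l2, m1, m2, rfl⟩ := local_decomp hl
      have e1 : specInt γp Λ (fun ω => h1 ω - h2 ω) =
          fun ω => specInt γp Λ h1 ω - specInt γp Λ h2 ω :=
        funext fun ω => specInt_sub γp l1.bm l2.bm Λ ω
      have e2 : specInt γm Λ (fun ω => h1 ω - h2 ω) =
          fun ω => specInt γm Λ h1 ω - specInt γm Λ h2 ω :=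
        funext fun ω => specInt_sub γm l1.bm l2.bm Λ ω
      rw [e1, e2]
      exact ⟨(hc Λ h1 l1 m1).1.sub (hc Λ h2 l2 m2).1, (hc Λ h1 l1 m1).2.sub (hc Λ h2 l2 m2).2⟩
    exact ⟨fun Λ f hl => (hc2 Λ f hl).1, fun Λ f hl => (hc2 Λ f hl).2⟩
  have c1 : μm (contSet γp) = 1 := by
    have h : contSet γp =ᵐ[μm] Set.univ :=
      eventuallyEq_univ.2 (hae4.mono fun ω h => (hcont ω h).1)
    rw [measure_congr h, measure_univ]
  have c2 : μm (contSet γm) = 1 := by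
    have h : contSet γm =ᵐ[μm] Set.univ :=
      eventuallyEq_univ.2 (hae4.mono fun ω h => (hcont ω h).2)
    rw [measure_congr h, measure_univ]
  exact ⟨hG, c1, c2, γp, hG, c1⟩

end Core
/-- If the relative entropy density of the "minus" measure with respect to the "plus"
measure of a translation-invariant monotonicity-preserving specification vanishes, then
the "minus" measure is consistent with the right-continuous specification `γ⁺`, gives
full mass to the continuity sets of `γ⁺` and `γ⁻`, and hence is almost quasilocal;
and the analogous statement with "+" and "−" interchanged. -/
theorem zero_relEnt_implies_almost_quasilocal
    {Ω₀ : Type*} [Fintype Ω₀] [MeasurableSpace Ω₀] [DiscreteMeasurableSpace Ω₀]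
    [LinearOrder Ω₀] [BoundedOrder Ω₀] [TopologicalSpace Ω₀] [DiscreteTopology Ω₀] {d : ℕ}
    (γ : Specification (Site d) Ω₀) (hTI : TransInvSpec γ) (hmono : MonoPreserving γ)
    (γp γm : Specification (Site d) Ω₀)
    (hγp : IsDirLimitSpec γ γp (fun _ => (⊤ : Ω₀)))
    (hγp' : SpecQuasilocalInDir γp (fun _ => (⊤ : Ω₀)))
    (hγm : IsDirLimitSpec γ γm (fun _ => (⊥ : Ω₀)))
    (hγm' : SpecQuasilocalInDir γm (fun _ => (⊥ : Ω₀)))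
    (μp μm : Measure (Site d → Ω₀))
    (hμp : IsLimitWithBoundary γ (fun _ => (⊤ : Ω₀)) μp)
    (hμm : IsLimitWithBoundary γ (fun _ => (⊥ : Ω₀)) μm) :
    (EntDensityZero μm μp →
      IsGibbs γp μm ∧ μm (contSet γp) = 1 ∧ μm (contSet γm) = 1 ∧ AlmostQuasilocal μm) ∧
    (EntDensityZero μp μm →
      IsGibbs γm μp ∧ μp (contSet γm) = 1 ∧ μp (contSet γp) = 1 ∧ AlmostQuasilocal μp) := by
  exact ⟨fun h => core_main γ hTI hmono ⊥ ⊤ (fun _ => bot_le) (fun _ => le_top) hγp hγm hμm hμp h,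
    fun h => @core_main Ω₀ _ _ _ d _ _ (dualPO Ω₀) γ hTI (mono_dual γ hmono) ⊤ ⊥ (fun _ => le_top)
      (fun _ => bot_le) γm γp hγm hγp μp μm hμp hμm h⟩


end
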